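/- There exists a continuous map ψ : 2^ℕ → K(ℝ²) into the hyperspace of compact subsets of the plane such that each ψ(a) is a compactification of (0,1] with remainder an arc, and for all a, b ∈ 2^ℕ, ψ(a) is homeomorphic to ψ(b) if and only if a and b are eventually equal. In particular, E₀ is Borel reducible to the homeomorphism relation restricted to a compact (hence Polish) family of spirals over [0,1]. -/

import Mathlib

open TopologicalSpace Set

/-- The relation `E₀` of eventual equality on the Cantor space `2^ℕ`. -/
def E0 (a b : ℕ → Bool) : Prop := ∃ m : ℕ, ∀ n ≥ m, a n = b n

namespace Sp16

open Filter Topology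

/-- depth of the dip at time `j`. -/
noncomputable def dd (a : ℕ → Bool) (j : ℕ) : ℝ :=
  open Classical in
  if IsSquare j then 1 else if IsSquare (j + 1) then (if a (Nat.sqrt j) then 1 / 2 else 0) else 1 / 2

/-- nearest natural number. -/
noncomputable def rho (t : ℝ) : ℕ := ⌊t + 1 / 2⌋₊

/-- the oscillating function. -/
noncomputable def ff (a : ℕ → Bool) (t : ℝ) : ℝ :=
  1 - dd a (rho t) * max 0 (1 - 2 * |t - rho t|)

lemma dd_cases (a : ℕ → Bool) (j : ℕ) : dd a j = 0 ∨ dd a j = 1 / 2 ∨ dd a j = 1 := by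
  unfold dd; split_ifs <;> simp

lemma dd_nonneg (a : ℕ → Bool) (j : ℕ) : 0 ≤ dd a j := by
  rcases dd_cases a j with h | h | h <;> rw [h] <;> norm_num

lemma dd_le (a : ℕ → Bool) (j : ℕ) : dd a j ≤ 1 := by
  rcases dd_cases a j with h | h | h <;> rw [h] <;> norm_num

lemma dd_sq (a : ℕ → Bool) {j : ℕ} (h : IsSquare j) : dd a j = 1 := by
  simp [dd, h]

lemma sq_of_dd {a : ℕ → Bool} {j : ℕ} (h : 1 / 2 < dd a j) : IsSquare j := by
  by_contra hc
  have : dd a j ≤ 1 / 2 := by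
    unfold dd; rw [if_neg hc]; split_ifs <;> norm_num
  linarith

lemma rho_mono : Monotone rho := fun s t h => Nat.floor_mono (by linarith)

lemma rho_abs {t : ℝ} (ht : 0 ≤ t) : (rho t : ℝ) ≤ t + 1 / 2 ∧ t < rho t + 1 / 2 := by
  constructor
  · exact Nat.floor_le (by linarith)
  · have := Nat.lt_floor_add_one (t + 1 / 2)
    unfold rho; linarith

lemma rho_eq {t : ℝ} {j : ℕ} (h1 : (j : ℝ) ≤ t + 1 / 2) (h2 : t < j + 1 / 2) : rho t = j := by
  unfold rho
  rw [Nat.floor_eq_iff (by have : (0:ℝ) ≤ j := by positivity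
                           linarith)]
  exact ⟨h1, by linarith⟩

lemma rho_nat (j : ℕ) : rho (j : ℝ) = j := rho_eq (by linarith) (by linarith)

lemma ff_nat (a : ℕ → Bool) (j : ℕ) : ff a j = 1 - dd a j := by
  simp [ff, rho_nat]

lemma ff_half (a : ℕ → Bool) (j : ℕ) : ff a (j + 1 / 2) = 1 := by
  have : rho ((j : ℝ) + 1 / 2) = j + 1 := rho_eq (by push_cast; linarith) (by push_cast; linarith)
  have h2 : |(j : ℝ) + 1 / 2 - (↑(j + 1) : ℝ)| = 1 / 2 := by
    push_cast
    rw [abs_of_nonpos] <;> linarith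
  unfold ff
  rw [this, h2]; norm_num

lemma ff_le (a : ℕ → Bool) (t : ℝ) : ff a t ≤ 1 := by
  have := mul_nonneg (dd_nonneg a (rho t)) (le_max_left (0:ℝ) (1 - 2 * |t - rho t|))
  unfold ff; linarith

lemma ff_ge (a : ℕ → Bool) (t : ℝ) : 1 - dd a (rho t) ≤ ff a t := by
  have h : max (0:ℝ) (1 - 2 * |t - rho t|) ≤ 1 :=
    max_le (by norm_num) (by linarith [abs_nonneg (t - rho t)])
  have := mul_le_mul_of_nonneg_left h (dd_nonneg a (rho t))
  unfold ff; linarith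

lemma ff_nonneg (a : ℕ → Bool) (t : ℝ) : 0 ≤ ff a t := by
  linarith [ff_ge a t, dd_le a (rho t)]

/-- on a cell, the function is quasi-convex. -/
lemma ff_cell (a : ℕ → Bool) {u s v : ℝ} (hu : u ≤ s) (hv : s ≤ v) (h : rho u = rho v) :
    ff a s ≤ max (ff a u) (ff a v) := by
  have hs : rho s = rho u := le_antisymm (h ▸ rho_mono hv) (rho_mono hu)
  unfold ff
  rw [hs, ← h]
  set j := rho u
  have key : ∀ w : ℝ, |s - j| ≤ |w - j| →
      1 - dd a j * max 0 (1 - 2 * |s - j|) ≤ 1 - dd a j * max 0 (1 - 2 * |w - j|) := by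
    intro w hw
    have : max (0:ℝ) (1 - 2 * |w - j|) ≤ max 0 (1 - 2 * |s - j|) :=
      max_le_max le_rfl (by linarith)
    have := mul_le_mul_of_nonneg_left this (dd_nonneg a j)
    linarith
  rcases le_total s j with hj | hj
  · refine le_max_of_le_left (key u ?_)
    rw [abs_of_nonpos (by linarith), abs_of_nonpos (by linarith)]; linarith
  · refine le_max_of_le_right (key v ?_)
    rw [abs_of_nonneg (by linarith), abs_of_nonneg (by linarith)]; linarith

lemma ff_eq_sum (a : ℕ → Bool) (N : ℕ) {t : ℝ} (ht : t < N) :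
    ff a t = 1 - ∑ j ∈ Finset.range (N + 1), dd a j * max 0 (1 - 2 * |t - j|) := by
  unfold ff
  rw [Finset.sum_eq_single (rho t)]
  · intro i _ hi
    have : 1 - 2 * |t - i| ≤ 0 := by
      by_contra hc
      push Not at hc
      have h2 : |t - i| < 1 / 2 := by linarith
      rw [abs_lt] at h2
      exact hi (rho_eq (by linarith) (by linarith)).symm
    rw [max_eq_left this, mul_zero]
  · intro h
    exfalso
    apply h
    rw [Finset.mem_range]
    by_cases h0 : 0 ≤ t
    · have := (rho_abs h0).1
      have h3 : ((rho t : ℕ) : ℝ) < (N + 1 : ℕ) := by push_cast; linarith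
      exact_mod_cast h3
    · push Not at h0
      have : rho t = 0 := by
        unfold rho
        rw [Nat.floor_eq_zero]; linarith
      omega

lemma ff_cont (a : ℕ → Bool) : Continuous (ff a) := by
  rw [continuous_iff_continuousAt]
  intro t
  obtain ⟨N, hN⟩ := exists_nat_gt t
  have hc : Continuous fun t : ℝ =>
      1 - ∑ j ∈ Finset.range (N + 1), dd a j * max 0 (1 - 2 * |t - j|) := by fun_prop
  refine hc.continuousAt.congr ?_
  filter_upwards [Iio_mem_nhds hN] with s hs
  exact (ff_eq_sum a N hs).symm

lemma dd_congr {a b : ℕ → Bool} {j : ℕ} (h : a (Nat.sqrt j) = b (Nat.sqrt j)) : dd a j = dd b j := by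
  unfold dd; rw [h]

lemma ff_congr {a b : ℕ → Bool} {t : ℝ} (h : a (Nat.sqrt (rho t)) = b (Nat.sqrt (rho t))) :
    ff a t = ff b t := by
  unfold ff; rw [dd_congr h]

lemma ff_nonpos (a b : ℕ → Bool) {t : ℝ} (h : t ≤ 0) : ff a t = ff b t := by
  have : rho t = 0 := by
    unfold rho
    rw [Nat.floor_eq_zero]; linarith
  unfold ff
  rw [this, dd_sq a (by simp), dd_sq b (by simp)]

lemma ff_surj (a : ℕ → Bool) {y : ℝ} (h0 : 0 ≤ y) (h1 : y ≤ 1) (T : ℝ) : ∃ t > T, ff a t = y := by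
  obtain ⟨N, hN⟩ := exists_nat_gt T
  have hNN : T < ((N * N : ℕ) : ℝ) := lt_of_lt_of_le hN (by exact_mod_cast Nat.le_mul_self N)
  have := intermediate_value_Icc (f := ff a) (a := ((N * N : ℕ) : ℝ))
    (b := ((N * N : ℕ) : ℝ) + 1 / 2) (by linarith) (ff_cont a).continuousOn
  rw [ff_half, ff_nat, dd_sq a ⟨N, rfl⟩, sub_self] at this
  obtain ⟨t, ht, rfl⟩ := this ⟨h0, h1⟩
  exact ⟨t, lt_of_lt_of_le hNN ht.1, rfl⟩

/-- one-sided matching of dips. -/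
def Half (a b : ℕ → Bool) (r r' : ℕ → ℕ) (N : ℕ) : Prop :=
  (∀ j ≥ N, 0 < dd a j → 0 < dd b (r j) ∧ r' (r j) = j ∧ (IsSquare j → IsSquare (r j))) ∧
  (∀ i j, N ≤ i → i < j → 0 < dd a i → 0 < dd a j → r i < r j) ∧
  ∀ M, ∃ K, ∀ j ≥ K, M ≤ r j

lemma not_sq {k j : ℕ} (h1 : k * k < j) (h2 : j < (k + 1) * (k + 1)) : ¬ IsSquare j := by
  rintro ⟨m, rfl⟩
  have := Nat.mul_self_lt_mul_self_iff.1 h1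
  have := Nat.mul_self_lt_mul_self_iff.1 h2
  omega

/-- the dips of block `k`. -/
noncomputable def dips (a : ℕ → Bool) (k : ℕ) : Finset ℕ :=
  open Classical in (Finset.Ioo (k * k) ((k + 1) * (k + 1))).filter (fun j => 0 < dd a j)

lemma mem_dips {a : ℕ → Bool} {k j : ℕ} :
    j ∈ dips a k ↔ (k * k < j ∧ j < (k + 1) * (k + 1)) ∧ 0 < dd a j := by
  simp [dips]

lemma dips_card (a : ℕ → Bool) (k : ℕ) (hk : 1 ≤ k) :
    (dips a k).card = 2 * k - 1 + (if a k then 1 else 0) := by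
  have e : (k + 1) * (k + 1) = k * k + 2 * k + 1 := by ring
  have hlast : dd a (k * k + 2 * k) = if a k then 1 / 2 else 0 := by
    have h1 : ¬ IsSquare (k * k + 2 * k) := not_sq (k := k) (by omega) (by omega)
    have h2 : IsSquare (k * k + 2 * k + 1) := ⟨k + 1, e.symm⟩
    have h3 : Nat.sqrt (k * k + 2 * k) = k := by
      rw [Nat.sqrt_add_eq]; omega
    unfold dd
    rw [if_neg h1, if_pos h2, h3]
  have hmid : ∀ j, k * k < j → j < k * k + 2 * k → 0 < dd a j := by
    intro j h1 h2
    have h3 : ¬ IsSquare j := not_sq (k := k) (by omega) (by omega)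
    have h4 : ¬ IsSquare (j + 1) := not_sq (k := k) (by omega) (by omega)
    unfold dd
    rw [if_neg h3, if_neg h4]; norm_num
  by_cases ha : a k
  · have : dips a k = Finset.Ioo (k * k) (k * k + 2 * k + 1) := by
      ext j
      rw [mem_dips, e, Finset.mem_Ioo]
      constructor
      · exact fun h => h.1
      · rintro ⟨h1, h2⟩
        refine ⟨⟨h1, h2⟩, ?_⟩
        rcases Nat.lt_succ_iff_lt_or_eq.1 h2 with h | h
        · exact hmid j h1 h
        · rw [h, hlast, if_pos ha]; norm_num
    rw [this, Nat.card_Ioo, if_pos ha]; omega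
  · have : dips a k = Finset.Ioo (k * k) (k * k + 2 * k) := by
      ext j
      rw [mem_dips, e, Finset.mem_Ioo]
      constructor
      · rintro ⟨⟨h1, h2⟩, h3⟩
        refine ⟨h1, ?_⟩
        rcases Nat.lt_succ_iff_lt_or_eq.1 h2 with h | h
        · exact h
        · rw [h, hlast, if_neg ha] at h3; exact absurd h3 (lt_irrefl _)
      · rintro ⟨h1, h2⟩
        exact ⟨⟨h1, by omega⟩, hmid j h1 h2⟩
    rw [this, Nat.card_Ioo, if_neg ha]; omega

lemma E0_of_half {a b : ℕ → Bool} {r r' : ℕ → ℕ} {N : ℕ} (H : Half a b r r' N)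
    (H' : Half b a r' r N) : E0 a b := by
  obtain ⟨A1, A2, A3⟩ := H
  obtain ⟨B1, B2, -⟩ := H'
  obtain ⟨K0, hK0⟩ := A3 (N + 1)
  refine ⟨N + K0 + 1, fun k hk => ?_⟩
  have hkk : k ≤ k * k := Nat.le_mul_self k
  have hkk' : k * k < (k + 1) * (k + 1) := Nat.mul_self_lt_mul_self (by omega)
  have p0 : 0 < dd a (k * k) := by rw [dd_sq a ⟨k, rfl⟩]; norm_num
  have p1 : 0 < dd a ((k + 1) * (k + 1)) := by rw [dd_sq a ⟨k + 1, rfl⟩]; norm_num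
  obtain ⟨-, i0, s0⟩ := A1 (k * k) (by omega) p0
  obtain ⟨-, i1, s1⟩ := A1 ((k + 1) * (k + 1)) (by omega) p1
  obtain ⟨l, hl⟩ := s0 ⟨k, rfl⟩
  obtain ⟨m, hm⟩ := s1 ⟨k + 1, rfl⟩
  have hN0 : N + 1 ≤ l * l := hl ▸ hK0 (k * k) (by omega)
  have hlm : l < m := by
    have := A2 _ _ (by omega) hkk' p0 p1
    rw [hl, hm] at this
    exact Nat.mul_self_lt_mul_self_iff.1 this
  rw [hl] at i0
  rw [hm] at i1
  have q : ∀ i, 0 < dd b (i * i) := fun i => by rw [dd_sq b ⟨i, rfl⟩]; norm_num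
  have hm1 : m = l + 1 := by
    by_contra hne
    have h1 : l * l < (l + 1) * (l + 1) := Nat.mul_self_lt_mul_self (by omega)
    have h2 : (l + 1) * (l + 1) < m * m := Nat.mul_self_lt_mul_self (by omega)
    have e1 := B2 _ _ (by omega) h1 (q _) (q _)
    have e2 := B2 _ _ (by omega) h2 (q _) (q _)
    rw [i0] at e1
    rw [i1] at e2
    exact not_sq e1 e2 ((B1 _ (by omega) (q _)).2.2 ⟨l + 1, rfl⟩)
  subst hm1
  have hcard : (dips a k).card = (dips b l).card := by
    refine Finset.card_nbij' r r' ?_ ?_ ?_ ?_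
    · intro j hj
      obtain ⟨⟨h1, h2⟩, h3⟩ := mem_dips.1 hj
      refine mem_dips.2 ⟨⟨?_, ?_⟩, (A1 j (by omega) h3).1⟩
      · rw [← hl]; exact A2 _ _ (by omega) h1 p0 h3
      · rw [← hm]; exact A2 _ _ (by omega) h2 h3 p1
    · intro j hj
      obtain ⟨⟨h1, h2⟩, h3⟩ := mem_dips.1 hj
      refine mem_dips.2 ⟨⟨?_, ?_⟩, (B1 j (by omega) h3).1⟩
      · rw [← i0]; exact B2 _ _ (by omega) h1 (q _) h3
      · rw [← i1]; exact B2 _ _ (by omega) h2 h3 (q _)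
    · intro j hj
      obtain ⟨⟨h1, h2⟩, h3⟩ := mem_dips.1 hj
      exact (A1 j (by omega) h3).2.1
    · intro j hj
      obtain ⟨⟨h1, h2⟩, h3⟩ := mem_dips.1 hj
      exact (B1 j (by omega) h3).2.1
  have hl1 : 1 ≤ l := by
    rcases Nat.eq_zero_or_pos l with h | h
    · subst h; omega
    · exact h
  rw [dips_card a k (by omega), dips_card b l hl1] at hcard
  have hkl : k = l := by
    split_ifs at hcard <;> omega
  subst hkl
  cases ha : a k <;> cases hb : b k <;> simp [ha, hb] at hcard ⊢

/-- time change data. -/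
structure TC (a b : ℕ → Bool) (G G' h : ℝ → ℝ) : Prop where
  mono : StrictMonoOn G (Ioi 1)
  gt : ∀ t > 1, 1 < G t
  gt' : ∀ t > 1, 1 < G' t
  inv : ∀ t > 1, G' (G t) = t
  inv' : ∀ t > 1, G (G' t) = t
  lim : ∀ M, ∃ T, ∀ t > T, M < G t
  app : ∀ ε > 0, ∃ T, ∀ t > T, |ff b (G t) - h (ff a t)| < ε

lemma half_of_TC {a b : ℕ → Bool} {G G' h : ℝ → ℝ} (H : TC a b G G' h)
    (h0 : h 0 = 0) (h1 : h 1 = 1) (h2 : h (1 / 2) < 1) :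
    ∃ N, ∀ N' ≥ N, Half a b (fun j => rho (G j)) (fun j => rho (G' j)) N' := by
  obtain ⟨ε, he0, he1, he2⟩ : ∃ ε > 0, ε < 1 / 4 ∧ h (1 / 2) + 2 * ε < 1 := by
    refine ⟨min (1 / 8) ((1 - h (1 / 2)) / 4), ?_, ?_, ?_⟩
    · exact lt_min (by norm_num) (by linarith)
    · exact lt_of_le_of_lt (min_le_left _ _) (by norm_num)
    · have := min_le_right (1 / 8) ((1 - h (1 / 2)) / 4)
      linarith
  obtain ⟨T, hT⟩ := H.app ε he0
  obtain ⟨T2, hT2⟩ := H.lim 2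
  obtain ⟨N, hN⟩ := exists_nat_gt (max (max T T2) 2 + 2)
  have hNT : T + 2 < N := lt_of_le_of_lt (by linarith [le_max_left T T2, le_max_left (max T T2) 2]) hN
  have hNT2 : T2 + 2 < N :=
    lt_of_le_of_lt (by linarith [le_max_right T T2, le_max_left (max T T2) 2]) hN
  have hN2 : (4:ℝ) < N := lt_of_le_of_lt (by linarith [le_max_right (max T T2) 2]) hN
  -- values at dips
  have dip : ∀ j : ℕ, N ≤ j → 0 < dd a j → ff b (G j) < 1 - ε := by
    intro j hj hd
    have hj' : (N:ℝ) ≤ j := by exact_mod_cast hj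
    have := hT j (by linarith)
    rw [ff_nat, abs_lt] at this
    rcases dd_cases a j with e | e | e
    · rw [e] at hd; exact absurd hd (lt_irrefl _)
    · rw [e, show (1:ℝ) - 1 / 2 = 1 / 2 by norm_num] at this; linarith
    · rw [e, show (1:ℝ) - 1 = 0 by norm_num, h0] at this; linarith
  have top : ∀ t : ℝ, T < t → ff a t = 1 → 1 - ε < ff b (G t) := by
    intro t ht e
    have := hT t ht
    rw [e, h1, abs_lt] at this; linarith
  have ddpos : ∀ t : ℝ, ff b t < 1 → 0 < dd b (rho t) := by
    intro t ht; linarith [ff_ge b t]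
  refine ⟨N, fun N' hN' => ⟨?_, ?_, ?_⟩⟩
  · intro j hj hd
    have hNj : N ≤ j := le_trans hN' hj
    have hj' : (N:ℝ) ≤ j := by exact_mod_cast hNj
    have hdip := dip j hNj hd
    refine ⟨ddpos _ (by linarith), ?_, ?_⟩
    · show rho (G' (rho (G j) : ℕ)) = j
      set m := rho (G j) with hm
      have hGj : 2 < G j := hT2 j (by linarith)
      have hmm := rho_abs (t := G j) (by linarith)
      have hm1 : (1:ℝ) < m := by rw [hm]; linarith
      have hfm : ff b m ≤ ff b (G j) := by
        rw [ff_nat]; exact ff_ge b (G j)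
      have hrm : rho (m:ℝ) = rho (G j) := rho_nat m
      by_contra hne
      have hg1 := H.gt' m hm1
      have hi := H.inv' m hm1
      have hin : ∀ p : ℝ, 1 < p → T < p → ff a p = 1 → (j ≤ p ∧ p ≤ G' m) ∨ (G' m ≤ p ∧ p ≤ j) →
          False := by
        intro p hp1 hpT hfp hc
        have ht := top p hpT hfp
        have hj1 : (j:ℝ) ∈ Ioi (1:ℝ) := by simp only [mem_Ioi]; linarith
        rcases hc with ⟨c1, c2⟩ | ⟨c1, c2⟩
        · have e1 := H.mono.monotoneOn hj1 hp1 c1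
          have e2 := H.mono.monotoneOn hp1 hg1 c2
          rw [hi] at e2
          have := ff_cell b e1 e2 hrm.symm
          rw [max_eq_left hfm] at this
          linarith
        · have e1 := H.mono.monotoneOn hp1 hj1 c2
          have e2 := H.mono.monotoneOn hg1 hp1 c1
          rw [hi] at e2
          have := ff_cell b e2 e1 hrm
          rw [max_eq_right hfm] at this
          linarith
      by_cases c1 : G' m < j + 1 / 2
      · have c2 : ¬ ((j:ℝ) ≤ G' m + 1 / 2) := fun c2 => hne (rho_eq c2 c1)
        obtain ⟨i, rfl⟩ : ∃ i, j = i + 1 := ⟨j - 1, by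
          have : (0:ℝ) < j := by linarith
          have : 0 < j := by exact_mod_cast this
          omega⟩
        push_cast at c2 hj'
        refine hin (i + 1 / 2) (by linarith) (by linarith) (ff_half a i) (Or.inr ⟨?_, ?_⟩)
        · linarith
        · push_cast; linarith
      · refine hin (j + 1 / 2) (by linarith) (by linarith) (ff_half a j) (Or.inl ⟨?_, ?_⟩)
        · linarith
        · linarith
    · intro hs
      have := hT j (by linarith)
      rw [ff_nat, dd_sq a hs, sub_self, h0, abs_lt] at this
      exact sq_of_dd (a := b) (by linarith [ff_ge b (G j)])
  · intro i j hi hij hdi hdj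
    have hNi : N ≤ i := le_trans hN' hi
    have hi' : (N:ℝ) ≤ i := by exact_mod_cast hNi
    have hij' : (i:ℝ) + 1 ≤ j := by exact_mod_cast hij
    have e1 : G i < G (i + 1 / 2) := H.mono (by simp only [mem_Ioi]; linarith)
      (by simp only [mem_Ioi]; linarith) (by linarith)
    have e2 : G (i + 1 / 2) < G j := H.mono (by simp only [mem_Ioi]; linarith)
      (by simp only [mem_Ioi]; linarith) (by linarith)
    refine lt_of_le_of_ne (rho_mono (e1.trans e2).le) fun he => ?_
    have := ff_cell b e1.le e2.le he
    have c1 := dip i hNi hdi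
    have c2 := dip j (by omega) hdj
    have c3 := top (i + 1 / 2) (by linarith) (ff_half a i)
    have := max_lt c1 c2
    linarith
  · intro M
    obtain ⟨K, hK⟩ := H.lim M
    obtain ⟨K', hK'⟩ := exists_nat_gt K
    refine ⟨K', fun j hj => ?_⟩
    have hj' : (K':ℝ) ≤ j := by exact_mod_cast hj
    have := hK j (by linarith)
    have h3 := rho_mono this.le
    rwa [rho_nat] at h3

lemma not_anti {a b : ℕ → Bool} {G G' h : ℝ → ℝ} (H : TC a b G G' h)
    (h0 : h 0 = 1) (h1 : h 1 = 0) (hm : StrictAntiOn h (Icc 0 1)) : False := by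
  have m0 : h (1 / 2) < 1 := by
    have := hm (a := 0) (b := 1 / 2) (by norm_num) (by norm_num) (by norm_num)
    rwa [h0] at this
  have m1 : 0 < h (1 / 2) := by
    have := hm (a := 1 / 2) (b := 1) (by norm_num) (by norm_num) (by norm_num)
    rwa [h1] at this
  obtain ⟨ε, he0, he1, he2, he3⟩ :
      ∃ ε > 0, ε < 1 / 4 ∧ h (1 / 2) + 2 * ε < 1 ∧ 2 * ε < h (1 / 2) := by
    refine ⟨min (1 / 8) (min ((1 - h (1 / 2)) / 4) (h (1 / 2) / 4)), ?_, ?_, ?_, ?_⟩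
    · exact lt_min (by norm_num) (lt_min (by linarith) (by linarith))
    · exact lt_of_le_of_lt (min_le_left _ _) (by norm_num)
    · have := (min_le_right (1 / 8) (min ((1 - h (1 / 2)) / 4) (h (1 / 2) / 4))).trans
        (min_le_left _ _)
      linarith
    · have := (min_le_right (1 / 8) (min ((1 - h (1 / 2)) / 4) (h (1 / 2) / 4))).trans
        (min_le_right _ _)
      linarith
  obtain ⟨T, hT⟩ := H.app ε he0
  obtain ⟨k, hk⟩ := exists_nat_gt (max T 2 + 2)
  have hkT : T + 2 < k := lt_of_le_of_lt (by linarith [le_max_left T 2]) hk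
  have hk4 : (4:ℝ) < k := lt_of_le_of_lt (by linarith [le_max_right T 2]) hk
  have hk4' : 4 < k := by exact_mod_cast hk4
  set i := k * k with hi
  have hki : (k:ℝ) ≤ i := by exact_mod_cast Nat.le_mul_self k
  have e : (k + 1) * (k + 1) = k * k + 2 * k + 1 := by ring
  have hdj : dd a (i + 1) = 1 / 2 := by
    have h3 : ¬ IsSquare (i + 1) := not_sq (k := k) (by omega) (by omega)
    have h4 : ¬ IsSquare (i + 1 + 1) := not_sq (k := k) (by omega) (by omega)
    unfold dd; rw [if_neg h3, if_neg h4]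
  have fj : ff a ((i + 1 : ℕ) : ℝ) = 1 / 2 := by rw [ff_nat, hdj]; norm_num
  have fu : ff a ((i:ℝ) + 1 / 2) = 1 := ff_half a i
  have fv : ff a (((i + 1 : ℕ) : ℝ) + 1 / 2) = 1 := ff_half a (i + 1)
  have gu := hT ((i:ℝ) + 1 / 2) (by linarith)
  have gv := hT (((i + 1 : ℕ) : ℝ) + 1 / 2) (by push_cast; linarith)
  have gj := hT ((i + 1 : ℕ) : ℝ) (by push_cast; linarith)
  rw [fu, h1, abs_lt] at gu
  rw [fv, h1, abs_lt] at gv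
  rw [fj, abs_lt] at gj
  have mu : ((i:ℝ) + 1 / 2) ∈ Ioi (1:ℝ) := by simp only [mem_Ioi]; linarith
  have mv : (((i + 1 : ℕ) : ℝ) + 1 / 2) ∈ Ioi (1:ℝ) := by
    simp only [mem_Ioi]; push_cast; linarith
  have mj : ((i + 1 : ℕ) : ℝ) ∈ Ioi (1:ℝ) := by simp only [mem_Ioi]; push_cast; linarith
  have c1 := H.mono mu mj (by push_cast; linarith)
  have c2 := H.mono mj mv (by linarith)
  set U := G ((i:ℝ) + 1 / 2)
  set V := G (((i + 1 : ℕ) : ℝ) + 1 / 2)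
  have hU1 : 1 < U := H.gt _ mu
  by_cases hr : rho U = rho V
  · have := ff_cell b c1.le c2.le hr
    have : max (ff b U) (ff b V) < ε := max_lt (by linarith) (by linarith)
    linarith
  · have hlt : rho U < rho V := lt_of_le_of_ne (rho_mono (c1.trans c2).le) hr
    have hlt' : (rho U : ℝ) + 1 ≤ rho V := by exact_mod_cast hlt
    have r1 := rho_abs (t := U) (by linarith)
    have r2 := rho_abs (t := V) (by linarith)
    set p : ℝ := rho U + 1 / 2 with hp
    have hp1 : 1 < p := by linarith
    have hfp : ff b p = 1 := ff_half b _
    have hs1 := H.gt' p hp1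
    have hs := H.inv' p hp1
    have d1 : (i:ℝ) + 1 / 2 ≤ G' p := by
      refine (H.mono.le_iff_le mu hs1).1 ?_
      rw [hs]; exact r1.2.le
    have d2 : G' p ≤ ((i + 1 : ℕ) : ℝ) + 1 / 2 := by
      refine (H.mono.le_iff_le hs1 mv).1 ?_
      rw [hs]; show p ≤ V; linarith
    have hgs := hT (G' p) (by linarith)
    rw [hs, hfp, abs_lt] at hgs
    have hfs : 1 / 2 ≤ ff a (G' p) := by
      rcases d2.lt_or_eq with d2 | d2
      · have : rho (G' p) = i + 1 := rho_eq (by push_cast; linarith) d2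
        have h5 := ff_ge a (G' p)
        rw [this, hdj] at h5; linarith
      · rw [d2, fv]; norm_num
    have := hm.antitoneOn (a := 1 / 2) (b := ff a (G' p)) (by norm_num)
      ⟨ff_nonneg a _, ff_le a _⟩ hfs
    linarith

/-- the spiral. -/
def XX (a : ℕ → Bool) : Set (ℝ × ℝ) :=
  {p | p.1 ∈ Icc (0:ℝ) 1 ∧ p.2 ∈ Icc (0:ℝ) 1 ∧ (p.1 ≠ 0 → p.2 = ff a p.1⁻¹)}

lemma ffinv_cont (a : ℕ → Bool) {x : ℝ} (hx : x ≠ 0) : ContinuousAt (fun x : ℝ => ff a x⁻¹) x :=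
  (ff_cont a).continuousAt.comp (continuousAt_inv₀ hx)

lemma XX_closed (a : ℕ → Bool) : IsClosed (XX a) := by
  have h1 : IsClosed {p : ℝ × ℝ | p.1 ≠ 0 → p.2 = ff a p.1⁻¹} := by
    rw [← isOpen_compl_iff, isOpen_iff_mem_nhds]
    intro p hp
    simp only [mem_compl_iff, mem_ofPred_eq, Classical.not_imp] at hp
    have c1 : ContinuousAt (fun q : ℝ × ℝ => q.2 - ff a q.1⁻¹) p :=
      continuousAt_snd.sub
        (ContinuousAt.comp (f := Prod.fst) (g := fun x : ℝ => ff a x⁻¹)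
          (ffinv_cont a hp.1) continuousAt_fst)
    have c2 : ContinuousAt (fun q : ℝ × ℝ => q.1) p := continuousAt_fst
    filter_upwards [c1.eventually_ne (sub_ne_zero.2 hp.2), c2.eventually_ne hp.1] with q h1 h2
    simp only [mem_compl_iff, mem_ofPred_eq, Classical.not_imp]
    exact ⟨h2, sub_ne_zero.1 h1⟩
  have h2 : IsClosed {p : ℝ × ℝ | p.1 ∈ Icc (0:ℝ) 1} := isClosed_Icc.preimage continuous_fst
  have h3 : IsClosed {p : ℝ × ℝ | p.2 ∈ Icc (0:ℝ) 1} := isClosed_Icc.preimage continuous_snd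
  exact h2.inter (h3.inter h1)

lemma XX_compact (a : ℕ → Bool) : IsCompact (XX a) :=
  (isCompact_Icc.prod isCompact_Icc).of_isClosed_subset (XX_closed a)
    (fun _ hp => ⟨hp.1, hp.2.1⟩)

lemma arc_mem (a : ℕ → Bool) {y : ℝ} (hy : y ∈ Icc (0:ℝ) 1) : ((0:ℝ), y) ∈ XX a :=
  ⟨by simp, hy, fun h => absurd rfl h⟩

lemma ray_mem (a : ℕ → Bool) {x : ℝ} (hx : x ∈ Ioc (0:ℝ) 1) : (x, ff a x⁻¹) ∈ XX a :=
  ⟨⟨hx.1.le, hx.2⟩, ⟨ff_nonneg a _, ff_le a _⟩, fun _ => rfl⟩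

/-- the map to the hyperspace. -/
def psi (a : ℕ → Bool) : NonemptyCompacts (ℝ × ℝ) :=
  ⟨⟨XX a, XX_compact a⟩, ⟨_, arc_mem a (y := 0) (by simp)⟩⟩

lemma psi_coe (a : ℕ → Bool) : (psi a : Set (ℝ × ℝ)) = XX a := rfl

lemma near {a b : ℕ → Bool} {T : ℝ} (hT : 0 < T) (h : ∀ t ≤ T, ff a t = ff b t) :
    ∀ p ∈ XX a, ∃ q ∈ XX b, dist p q ≤ T⁻¹ := by
  intro p hp
  obtain ⟨h1, h2, h3⟩ := hp
  by_cases hx : T⁻¹ ≤ p.1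
  · have hpos : 0 < p.1 := lt_of_lt_of_le (inv_pos.2 hT) hx
    refine ⟨p, ⟨h1, h2, fun h0 => ?_⟩, by rw [dist_self]; exact (inv_pos.2 hT).le⟩
    rw [h3 h0]
    exact h _ (inv_le_of_inv_le₀ hT hx)
  · push Not at hx
    refine ⟨(0, p.2), arc_mem b h2, ?_⟩
    rw [Prod.dist_eq]
    simp only [dist_self, Real.dist_eq, sub_zero]
    refine max_le ?_ (inv_pos.2 hT).le
    rw [abs_of_nonneg h1.1]; exact hx.le

lemma psi_cont : Continuous psi := by
  rw [continuous_iff_continuousAt]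
  intro a
  rw [ContinuousAt, Metric.tendsto_nhds]
  intro ε hε
  obtain ⟨T, hT⟩ := exists_nat_gt (max 1 ε⁻¹)
  have hT1 : (1:ℝ) < T := lt_of_le_of_lt (le_max_left _ _) hT
  have hT2 : ε⁻¹ < (T:ℝ) := lt_of_le_of_lt (le_max_right _ _) hT
  have ev : ∀ᶠ b in 𝓝 a, ∀ i ∈ Finset.range (T + 1), b i = a i := by
    rw [Filter.eventually_all_finset]
    intro i _
    have : ContinuousAt (fun b : ℕ → Bool => b i) a := (continuous_apply i).continuousAt
    exact this.eventually (p := fun c => c = a i) (by simp [nhds_discrete])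
  filter_upwards [ev] with b hb
  have hf : ∀ t ≤ (T:ℝ), ff b t = ff a t := by
    intro t ht
    apply ff_congr
    apply hb
    rw [Finset.mem_range]
    have h1 : rho t ≤ T := by
      have := rho_mono ht
      rwa [rho_nat] at this
    have := Nat.sqrt_le_self (rho t)
    omega
  rw [Metric.NonemptyCompacts.dist_eq]
  refine lt_of_le_of_lt (Metric.hausdorffDist_le_of_mem_dist (r := (T:ℝ)⁻¹) (by positivity)
    (near (by linarith) hf) (near (by linarith) fun t ht => (hf t ht).symm)) ?_
  exact inv_lt_of_inv_lt₀ hε hT2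

/-- the ray part. -/
def DD (a : ℕ → Bool) : Set (ℝ × ℝ) := {p | p ∈ XX a ∧ p.1 ≠ 0}

lemma dense_Ioo (a : ℕ → Bool) : XX a ⊆ closure ((fun x : ℝ => (x, ff a x⁻¹)) '' Ioo 0 1) := by
  rintro ⟨x, y⟩ ⟨h1, h2, h3⟩
  simp only at h1 h2 h3
  by_cases hx : x = 0
  · subst hx
    rw [Metric.mem_closure_iff]
    intro ε hε
    obtain ⟨t, ht, rfl⟩ := ff_surj a h2.1 h2.2 (max 1 ε⁻¹)
    have ht1 : (1:ℝ) < t := lt_of_le_of_lt (le_max_left _ _) ht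
    have ht2 : ε⁻¹ < t := lt_of_le_of_lt (le_max_right _ _) ht
    have htp : 0 < t⁻¹ := inv_pos.2 (by linarith)
    refine ⟨(t⁻¹, ff a t), ⟨t⁻¹, ⟨htp, inv_lt_one_of_one_lt₀ ht1⟩, by simp⟩, ?_⟩
    rw [Prod.dist_eq]
    simp only [dist_self, Real.dist_eq, zero_sub, abs_neg]
    refine max_lt ?_ hε
    rw [abs_of_pos htp]; exact inv_lt_of_inv_lt₀ hε ht2
  · rw [h3 hx]
    have c : ContinuousAt (fun x : ℝ => (x, ff a x⁻¹)) x := continuousAt_id.prodMk (ffinv_cont a hx)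
    exact c.continuousWithinAt.mem_closure_image
      (by rw [closure_Ioo (by norm_num)]; exact h1)

lemma DD_props (a : ℕ → Bool) : DD a ⊆ XX a ∧ Nonempty (↥(DD a) ≃ₜ ↥(Set.Ioc (0:ℝ) 1)) ∧
    XX a ⊆ closure (DD a) ∧ Nonempty (↥(XX a \ DD a) ≃ₜ ↥(Set.Icc (0:ℝ) 1)) := by
  refine ⟨fun p hp => hp.1, ⟨?_⟩, ?_, ⟨?_⟩⟩
  · exact
    { toFun := fun p => ⟨p.1.1, lt_of_le_of_ne p.2.1.1.1 (Ne.symm p.2.2), p.2.1.1.2⟩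
      invFun := fun x => ⟨(x.1, ff a x.1⁻¹), ray_mem a x.2, x.2.1.ne'⟩
      left_inv := fun p => by
        apply Subtype.ext
        exact Prod.ext rfl (p.2.1.2.2 p.2.2).symm
      right_inv := fun x => rfl
      continuous_toFun := by fun_prop
      continuous_invFun := by
        refine Continuous.subtype_mk (Continuous.prodMk continuous_subtype_val ?_) _
        refine (ff_cont a).comp ?_
        exact continuous_subtype_val.inv₀ fun x => x.2.1.ne' }
  · refine (dense_Ioo a).trans (closure_mono ?_)
    rintro _ ⟨x, hx, rfl⟩
    exact ⟨ray_mem a ⟨hx.1, hx.2.le⟩, hx.1.ne'⟩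
  · have hz : ∀ p : ↥(XX a \ DD a), p.1.1 = 0 := fun p => by
      by_contra h
      exact p.2.2 ⟨p.2.1, h⟩
    exact
    { toFun := fun p => ⟨p.1.2, p.2.1.2.1⟩
      invFun := fun y => ⟨(0, y.1), arc_mem a y.2, fun h => h.2 rfl⟩
      left_inv := fun p => by
        apply Subtype.ext
        exact Prod.ext (hz p).symm rfl
      right_inv := fun x => rfl
      continuous_toFun := by fun_prop
      continuous_invFun := by fun_prop }

lemma homeo_of_E0 {a b : ℕ → Bool} (h : E0 a b) : Nonempty (↥(XX a) ≃ₜ ↥(XX b)) := by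
  obtain ⟨m, hm⟩ := h
  have hlarge : ∀ t : ℝ, (m * m : ℕ) ≤ t → ff a t = ff b t := by
    intro t ht
    apply ff_congr
    apply hm
    have := rho_mono ht
    rw [rho_nat] at this
    exact Nat.le_sqrt.2 this
  have hD : Continuous fun x : ℝ => ff b x⁻¹ - ff a x⁻¹ := by
    rw [continuous_iff_continuousAt]
    intro x
    by_cases hx : x = 0
    · subst hx
      have : (fun _ : ℝ => (0:ℝ)) =ᶠ[𝓝 0] fun x : ℝ => ff b x⁻¹ - ff a x⁻¹ := by
        have hpos : (0:ℝ) < ((m * m : ℕ) + 1 : ℝ)⁻¹ := by positivity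
        filter_upwards [Iio_mem_nhds hpos] with x hx
        rcases le_or_gt x 0 with h | h
        · rw [ff_nonpos b a (inv_nonpos.2 h), sub_self]
        · rw [hlarge, sub_self]
          have := lt_inv_of_lt_inv₀ h hx
          linarith
      exact continuousAt_const.congr this
    · exact (ffinv_cont b hx).sub (ffinv_cont a hx)
  have key : ∀ a b : ℕ → Bool, ∀ p ∈ XX a, (p.1, p.2 + (ff b p.1⁻¹ - ff a p.1⁻¹)) ∈ XX b := by
    rintro a b ⟨x, y⟩ ⟨h1, h2, h3⟩
    simp only at h1 h2 h3 ⊢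
    by_cases hx : x = 0
    · subst hx
      rw [ff_nonpos b a (by simp), sub_self, add_zero]
      exact arc_mem b h2
    · rw [h3 hx, add_sub_cancel]
      exact ray_mem b ⟨lt_of_le_of_ne h1.1 (Ne.symm hx), h1.2⟩
  have hD' : Continuous fun x : ℝ => ff a x⁻¹ - ff b x⁻¹ := by
    refine hD.neg.congr fun x => ?_
    simp only [Pi.neg_apply, neg_sub]
  exact ⟨
    { toFun := fun p => ⟨_, key a b p.1 p.2⟩
      invFun := fun p => ⟨_, key b a p.1 p.2⟩
      left_inv := fun p => by
        apply Subtype.ext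
        exact Prod.ext rfl (by dsimp only; ring)
      right_inv := fun p => by
        apply Subtype.ext
        exact Prod.ext rfl (by dsimp only; ring)
      continuous_toFun := by
        have := hD.comp (continuous_fst.comp (continuous_subtype_val (p := fun p => p ∈ XX a)))
        refine Continuous.subtype_mk (Continuous.prodMk (by fun_prop) (Continuous.add (by fun_prop) this)) _
      continuous_invFun := by
        have := hD'.comp (continuous_fst.comp (continuous_subtype_val (p := fun p => p ∈ XX b)))
        refine Continuous.subtype_mk (Continuous.prodMk (by fun_prop) (Continuous.add (by fun_prop) this)) _ }⟩

lemma conn_of_end (a : ℕ → Bool) {p : ℝ × ℝ} (hp : p ∈ XX a) (h : ¬ (0 < p.1 ∧ p.1 < 1)) :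
    IsPreconnected (XX a \ {p}) := by
  have hc : IsPreconnected ((fun x : ℝ => (x, ff a x⁻¹)) '' Ioo 0 1) := by
    refine isPreconnected_Ioo.image _ fun x hx => ?_
    exact (continuousAt_id.prodMk (ffinv_cont a hx.1.ne')).continuousWithinAt
  refine hc.subset_closure ?_ (sdiff_subset.trans (dense_Ioo a))
  rintro _ ⟨x, hx, rfl⟩
  refine ⟨ray_mem a ⟨hx.1, hx.2.le⟩, ?_⟩
  rintro rfl
  exact h hx

lemma not_conn (a : ℕ → Bool) {p : ℝ × ℝ} (hp : p ∈ XX a) (h : 0 < p.1 ∧ p.1 < 1) :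
    ¬ IsPreconnected (XX a \ {p}) := by
  intro hc
  have m0 : ((0:ℝ), (0:ℝ)) ∈ XX a \ {p} := by
    refine ⟨arc_mem a (by simp), ?_⟩
    rintro rfl
    exact lt_irrefl _ h.1
  have m1 : ((1:ℝ), ff a (1:ℝ)⁻¹) ∈ XX a \ {p} := by
    refine ⟨ray_mem a (by simp), ?_⟩
    rintro rfl
    exact lt_irrefl _ h.2
  have := hc.image Prod.fst continuous_fst.continuousOn
  obtain ⟨q, hq, hq1⟩ := this.Icc_subset ⟨_, m0, rfl⟩ ⟨_, m1, rfl⟩ ⟨h.1.le, h.2.le⟩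
  apply hq.2
  have hne : p.1 ≠ 0 := h.1.ne'
  refine Prod.ext hq1 ?_
  rw [hq.1.2.2 (by rw [hq1]; exact hne), hp.2.2 hne, hq1]

lemma conn_iff (a : ℕ → Bool) (p : ↥(XX a)) :
    IsPreconnected ({p}ᶜ : Set ↥(XX a)) ↔ ¬ (0 < p.1.1 ∧ p.1.1 < 1) := by
  have e : (Subtype.val '' ({p}ᶜ : Set ↥(XX a))) = XX a \ {p.1} := by
    ext q
    constructor
    · rintro ⟨q, hq, rfl⟩
      exact ⟨q.2, fun h => hq (Subtype.ext h)⟩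
    · rintro ⟨h1, h2⟩
      exact ⟨⟨q, h1⟩, fun h => h2 (congrArg Subtype.val h), rfl⟩
  rw [← Topology.IsInducing.subtypeVal.isPreconnected_image, e]
  exact ⟨fun hc h => not_conn a p.2 h hc, fun h => conn_of_end a p.2 h⟩

lemma cut_iff {a b : ℕ → Bool} (Φ : ↥(XX a) ≃ₜ ↥(XX b)) (p : ↥(XX a)) :
    (0 < (Φ p).1.1 ∧ (Φ p).1.1 < 1) ↔ (0 < p.1.1 ∧ p.1.1 < 1) := by
  have : IsPreconnected ({Φ p}ᶜ : Set ↥(XX b)) ↔ IsPreconnected ({p}ᶜ : Set ↥(XX a)) := by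
    rw [← Φ.isPreconnected_image, Set.image_compl_eq Φ.bijective, Set.image_singleton]
  rw [conn_iff, conn_iff] at this
  tauto

/-- parametrisation of the ray by time. -/
noncomputable def pt (a : ℕ → Bool) (t : ℝ) : ↥(XX a) :=
  ⟨((max 1 t)⁻¹, ff a (max 1 t)), by
    have h1 : (1:ℝ) ≤ max 1 t := le_max_left _ _
    have := ray_mem a (x := (max 1 t)⁻¹) ⟨inv_pos.2 (by linarith), inv_le_one_of_one_le₀ h1⟩
    rwa [inv_inv] at this⟩

lemma pt_val (a : ℕ → Bool) {t : ℝ} (ht : 1 < t) : (pt a t).1 = (t⁻¹, ff a t) := by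
  simp [pt, max_eq_right ht.le]

lemma pt_cont (a : ℕ → Bool) : Continuous (pt a) := by
  have hm : Continuous fun t : ℝ => max 1 t := by fun_prop
  refine Continuous.subtype_mk (Continuous.prodMk (hm.inv₀ fun t => ?_) ((ff_cont a).comp hm)) _
  have h1 : (1:ℝ) ≤ max 1 t := le_max_left _ _
  linarith

lemma eq_pt (a : ℕ → Bool) (p : ↥(XX a)) (h : 0 < p.1.1 ∧ p.1.1 < 1) : p = pt a (p.1.1)⁻¹ := by
  apply Subtype.ext
  rw [pt_val a ((one_lt_inv₀ h.1).2 h.2)]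
  exact Prod.ext (by simp) (p.2.2.2 h.1.ne')

/-- parametrisation of the arc. -/
noncomputable def ar (a : ℕ → Bool) (y : ℝ) : ↥(XX a) :=
  ⟨(0, (projIcc (0:ℝ) 1 zero_le_one y : ℝ)), arc_mem a (projIcc (0:ℝ) 1 zero_le_one y).2⟩

lemma ar_val (a : ℕ → Bool) {y : ℝ} (hy : y ∈ Icc (0:ℝ) 1) : (ar a y).1 = (0, y) := by
  simp [ar, projIcc_of_mem _ hy]

lemma ar_cont (a : ℕ → Bool) : Continuous (ar a) := by
  refine Continuous.subtype_mk (Continuous.prodMk continuous_const ?_) _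
  exact continuous_subtype_val.comp continuous_projIcc

lemma eq_ar (a : ℕ → Bool) (p : ↥(XX a)) (h : p.1.1 = 0) : p = ar a p.1.2 := by
  apply Subtype.ext
  rw [ar_val a p.2.2.1]
  exact Prod.ext h rfl

/-- induced time change. -/
noncomputable def GG {a b : ℕ → Bool} (Φ : ↥(XX a) ≃ₜ ↥(XX b)) (t : ℝ) : ℝ := ((Φ (pt a t)).1.1)⁻¹

/-- induced map of the arc. -/
noncomputable def hh {a b : ℕ → Bool} (Φ : ↥(XX a) ≃ₜ ↥(XX b)) (y : ℝ) : ℝ := (Φ (ar a y)).1.2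

section
variable {a b : ℕ → Bool} (Φ : ↥(XX a) ≃ₜ ↥(XX b))

lemma pt_int {t : ℝ} (ht : 1 < t) : 0 < (Φ (pt a t)).1.1 ∧ (Φ (pt a t)).1.1 < 1 := by
  rw [cut_iff, pt_val a ht]
  exact ⟨inv_pos.2 (by linarith), inv_lt_one_of_one_lt₀ ht⟩

lemma Φ_pt {t : ℝ} (ht : 1 < t) : Φ (pt a t) = pt b (GG Φ t) := eq_pt b _ (pt_int Φ ht)

lemma GG_gt {t : ℝ} (ht : 1 < t) : 1 < GG Φ t :=
  (one_lt_inv₀ (pt_int Φ ht).1).2 (pt_int Φ ht).2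

lemma GG_inv {t : ℝ} (ht : 1 < t) : GG Φ.symm (GG Φ t) = t := by
  rw [GG, ← Φ_pt Φ ht, Φ.symm_apply_apply, pt_val a ht]; simp

lemma ar_zero {y : ℝ} (hy : y ∈ Icc (0:ℝ) 1) : (Φ (ar a y)).1.1 = 0 := by
  have h01 : ∀ y, (Φ (ar a y)).1.1 = 0 ∨ (Φ (ar a y)).1.1 = 1 := by
    intro y
    have h1 := (cut_iff Φ (ar a y)).not.2 (fun h => lt_irrefl _ h.1)
    have h2 := (Φ (ar a y)).2.1
    by_contra hc
    push Not at hc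
    exact h1 ⟨lt_of_le_of_ne h2.1 (Ne.symm hc.1), lt_of_le_of_ne h2.2 hc.2⟩
  have hcont : Continuous fun y => (Φ (ar a y)).1.1 :=
    continuous_fst.comp (continuous_subtype_val.comp (Φ.continuous.comp (ar_cont a)))
  have hconst : ∀ y z, (Φ (ar a y)).1.1 = 0 → (Φ (ar a z)).1.1 = 1 → False := by
    intro y z hy hz
    have := isPreconnected_univ.image _ hcont.continuousOn
    obtain ⟨w, -, hw⟩ := this.Icc_subset ⟨y, trivial, rfl⟩ ⟨z, trivial, rfl⟩
      (show (1 / 2 : ℝ) ∈ _ by simp only [hy, hz]; norm_num)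
    simp only at hw
    rcases h01 w with h | h <;> rw [h] at hw <;> norm_num at hw
  rcases h01 y with h | h
  · exact h
  · exfalso
    have hall : ∀ z, (Φ (ar a z)).1.1 = 1 := fun z => (h01 z).resolve_left fun h' => hconst z y h' h
    have heq : Φ (ar a 0) = Φ (ar a 1) := by
      apply Subtype.ext
      refine Prod.ext (by rw [hall, hall]) ?_
      rw [(Φ (ar a 0)).2.2.2 (by rw [hall]; norm_num), (Φ (ar a 1)).2.2.2 (by rw [hall]; norm_num),
        hall, hall]
    have := congrArg (fun p => p.1.2) (Φ.injective heq)
    simp only [ar_val a (show (0:ℝ) ∈ Icc (0:ℝ) 1 by simp),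
      ar_val a (show (1:ℝ) ∈ Icc (0:ℝ) 1 by simp)] at this
    norm_num at this

lemma Φ_ar {y : ℝ} (hy : y ∈ Icc (0:ℝ) 1) : Φ (ar a y) = ar b (hh Φ y) := eq_ar b _ (ar_zero Φ hy)

lemma hh_mem (y : ℝ) : hh Φ y ∈ Icc (0:ℝ) 1 := (Φ (ar a y)).2.2.1

lemma hh_inv {y : ℝ} (hy : y ∈ Icc (0:ℝ) 1) : hh Φ.symm (hh Φ y) = y := by
  rw [hh, ← Φ_ar Φ hy, Φ.symm_apply_apply, ar_val a hy]

lemma hh_cont : Continuous (hh Φ) :=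
  continuous_snd.comp (continuous_subtype_val.comp (Φ.continuous.comp (ar_cont a)))

lemma unif {ε : ℝ} (hε : 0 < ε) : ∃ T, ∀ t > T, 1 < t ∧ dist (Φ (pt a t)) (Φ (ar a (ff a t))) < ε := by
  have : CompactSpace ↥(XX a) := isCompact_iff_compactSpace.1 (XX_compact a)
  have hu := CompactSpace.uniformContinuous_of_continuous Φ.continuous
  rw [Metric.uniformContinuous_iff] at hu
  obtain ⟨δ, hδ, hd⟩ := hu ε hε
  refine ⟨max 1 δ⁻¹, fun t ht => ?_⟩
  have ht1 : (1:ℝ) < t := lt_of_le_of_lt (le_max_left _ _) ht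
  have ht2 : δ⁻¹ < t := lt_of_le_of_lt (le_max_right _ _) ht
  refine ⟨ht1, hd ?_⟩
  rw [Subtype.dist_eq, pt_val a ht1, ar_val a ⟨ff_nonneg a t, ff_le a t⟩, Prod.dist_eq]
  simp only [dist_self, Real.dist_eq, sub_zero]
  refine max_lt ?_ hδ
  rw [abs_of_pos (inv_pos.2 (by linarith))]
  exact inv_lt_of_inv_lt₀ hδ ht2

lemma unif' {ε : ℝ} (hε : 0 < ε) :
    ∃ T, ∀ t > T, 1 < t ∧ (GG Φ t)⁻¹ < ε ∧ |ff b (GG Φ t) - hh Φ (ff a t)| < ε := by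
  obtain ⟨T, hT⟩ := unif Φ hε
  refine ⟨T, fun t ht => ?_⟩
  obtain ⟨h1, h2⟩ := hT t ht
  have hg := GG_gt Φ h1
  rw [Φ_pt Φ h1, Φ_ar Φ ⟨ff_nonneg a t, ff_le a t⟩, Subtype.dist_eq, pt_val b hg,
    ar_val b (hh_mem Φ _), Prod.dist_eq] at h2
  simp only [Real.dist_eq, sub_zero] at h2
  refine ⟨h1, ?_, lt_of_le_of_lt (le_max_right _ _) h2⟩
  exact lt_of_le_of_lt (le_abs_self _) (lt_of_le_of_lt (le_max_left _ _) h2)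

lemma GG_lim (M : ℝ) : ∃ T, ∀ t > T, M < GG Φ t := by
  obtain ⟨T, hT⟩ := unif' Φ (ε := (max 1 M)⁻¹) (inv_pos.2 (lt_of_lt_of_le one_pos (le_max_left _ _)))
  refine ⟨T, fun t ht => ?_⟩
  obtain ⟨h1, h2, -⟩ := hT t ht
  have hg := GG_gt Φ h1
  have := (inv_lt_inv₀ (by linarith) (lt_of_lt_of_le one_pos (le_max_left _ _))).1 h2
  exact lt_of_le_of_lt (le_max_right _ _) this

lemma GG_mono : StrictMonoOn (GG Φ) (Ioi 1) := by
  intro x hx y hy hxy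
  obtain ⟨T, hT⟩ := GG_lim Φ (GG Φ x)
  set Z := max y (T + 1) with hZ
  have hyZ : y ≤ Z := le_max_left _ _
  have hTZ : T < Z := lt_of_lt_of_le (by linarith) (le_max_right y (T + 1))
  have hsub : ∀ t ∈ Icc x Z, 1 < t := fun t ht => lt_of_lt_of_le hx ht.1
  have hc : ContinuousOn (GG Φ) (Icc x Z) := by
    intro t ht
    have h1 : Continuous fun t => (Φ (pt a t)).1.1 :=
      continuous_fst.comp (continuous_subtype_val.comp (Φ.continuous.comp (pt_cont a)))
    exact (h1.continuousAt.inv₀ (pt_int Φ (hsub t ht)).1.ne').continuousWithinAt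
  have hi : InjOn (GG Φ) (Icc x Z) := by
    intro s hs t ht h
    rw [← GG_inv Φ (hsub s hs), h, GG_inv Φ (hsub t ht)]
  exact hc.strictMonoOn_of_injOn_Icc (by linarith) (hT Z hTZ).le hi
    ⟨le_rfl, by linarith⟩ ⟨hxy.le, hyZ⟩ hxy

lemma TC_of : TC a b (GG Φ) (GG Φ.symm) (hh Φ) where
  mono := GG_mono Φ
  gt := fun _ ht => GG_gt Φ ht
  gt' := fun _ ht => GG_gt Φ.symm ht
  inv := fun _ ht => GG_inv Φ ht
  inv' := fun _ ht => GG_inv Φ.symm ht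
  lim := GG_lim Φ
  app := fun ε hε => by
    obtain ⟨T, hT⟩ := unif' Φ hε
    exact ⟨T, fun t ht => (hT t ht).2.2⟩

lemma hh_vals : hh Φ 0 = 0 ∧ hh Φ 1 = 1 ∧ hh Φ (1 / 2) < 1 := by
  have hi : InjOn (hh Φ) (Icc 0 1) := by
    intro s hs t ht h
    rw [← hh_inv Φ hs, h, hh_inv Φ ht]
  have i0 : (0:ℝ) ∈ Icc (0:ℝ) 1 := by simp
  have i1 : (1:ℝ) ∈ Icc (0:ℝ) 1 := by simp
  have e0 : hh Φ (hh Φ.symm 0) = 0 := hh_inv Φ.symm i0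
  have e1 : hh Φ (hh Φ.symm 1) = 1 := hh_inv Φ.symm i1
  have m0 := hh_mem Φ.symm 0
  have m1 := hh_mem Φ.symm 1
  rcases (hh_cont Φ).continuousOn.strictMonoOn_of_injOn_Icc' zero_le_one hi with h | h
  · have a0 := h.monotoneOn i0 m0 m0.1
    have a1 := h.monotoneOn m1 i1 m1.2
    rw [e0] at a0
    rw [e1] at a1
    have z0 : hh Φ 0 = 0 := le_antisymm a0 (hh_mem Φ 0).1
    have z1 : hh Φ 1 = 1 := le_antisymm (hh_mem Φ 1).2 a1
    refine ⟨z0, z1, ?_⟩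
    have := h (a := 1 / 2) (b := 1) (by norm_num) (by norm_num) (by norm_num)
    rwa [z1] at this
  · exfalso
    have a0 := h.antitoneOn i0 m1 m1.1
    have a1 := h.antitoneOn m0 i1 m0.2
    rw [e1] at a0
    rw [e0] at a1
    exact not_anti (TC_of Φ) (le_antisymm (hh_mem Φ 0).2 a0) (le_antisymm a1 (hh_mem Φ 1).1) h

lemma E0_of_homeo (Φ : ↥(XX a) ≃ₜ ↥(XX b)) : E0 a b := by
  obtain ⟨a0, a1, a2⟩ := hh_vals Φ
  obtain ⟨b0, b1, b2⟩ := hh_vals Φ.symm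
  obtain ⟨N1, h1⟩ := half_of_TC (TC_of Φ) a0 a1 a2
  obtain ⟨N2, h2⟩ := half_of_TC (TC_of Φ.symm) b0 b1 b2
  exact E0_of_half (h1 (max N1 N2) (le_max_left _ _)) (h2 (max N1 N2) (le_max_right _ _))

end

end Sp16

/-- There is a continuous map `ψ : 2^ℕ → K(ℝ²)` such that each `ψ a` is a
compactification of `(0,1]` with remainder an arc (i.e. a spiral over `[0,1]`:
it contains a dense copy `D` of `(0,1]` whose complement is an arc), and
`ψ a` is homeomorphic to `ψ b` iff `a` and `b` are eventually equal. In particular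
`E₀` is Borel reducible to the homeomorphism relation restricted to the compact
(hence Polish) family `ψ(2^ℕ)` of spirals over `[0,1]`. -/
theorem stmt_16 :
    ∃ ψ : (ℕ → Bool) → NonemptyCompacts (ℝ × ℝ),
      Continuous ψ ∧
      (∀ a : ℕ → Bool, ∃ D : Set (ℝ × ℝ),
        D ⊆ (ψ a : Set (ℝ × ℝ)) ∧
        Nonempty (↥D ≃ₜ ↥(Set.Ioc (0:ℝ) 1)) ∧
        (ψ a : Set (ℝ × ℝ)) ⊆ closure D ∧
        Nonempty (↥((ψ a : Set (ℝ × ℝ)) \ D) ≃ₜ ↥(Set.Icc (0:ℝ) 1))) ∧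
      (∀ a b : ℕ → Bool,
        (Nonempty (↥(ψ a : Set (ℝ × ℝ)) ≃ₜ ↥(ψ b : Set (ℝ × ℝ))) ↔ E0 a b)) :=
  ⟨Sp16.psi, Sp16.psi_cont, fun a => ⟨Sp16.DD a, Sp16.DD_props a⟩,
    fun _ _ => ⟨fun ⟨Φ⟩ => Sp16.E0_of_homeo Φ, fun h => Sp16.homeo_of_E0 h⟩⟩
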